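/- arXiv:2008.00690 — 9 statements merged into one kernel-verified Lean document; each statement's English description precedes it below -/
import Mathlib

section
/- Let a > 0, p > 0, q > 0, c ∈ ℝ and ε > 0, and for each natural number N set I(N) = ∫₀^ε exp(−a·N²·t^p + c·N·t^q) dt. Then lim_{N→∞} (1/N)·log I(N) = 0. -/
open Real MeasureTheory Filter

/-- The integrand `t ↦ exp(−a n² t^p + c n t^q)` is continuous. -/
theorem continuous_exp_rpow_add_rpow {p q : ℝ} (a c n : ℝ) (hp : 0 < p) (hq : 0 < q) :
    Continuous fun t : ℝ => Real.exp (-a * n ^ 2 * t ^ p + c * n * t ^ q) := by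
  have h1 : Continuous fun t : ℝ => t ^ p := Real.continuous_rpow_const hp.le
  have h2 : Continuous fun t : ℝ => t ^ q := Real.continuous_rpow_const hq.le
  fun_prop

/-- Lower bound for the integral, obtained by restricting it to `(0, s)`. -/
theorem mul_exp_le_integral_exp_rpow {a p q c ε n s : ℝ} (ha : 0 < a) (hp : 0 < p) (hq : 0 < q)
    (hn : 0 ≤ n) (hs : 0 < s) (hsε : s ≤ ε) :
    s * Real.exp (-a * n ^ 2 * s ^ p - |c| * n * s ^ q) ≤
      ∫ t in (0 : ℝ)..ε, Real.exp (-a * n ^ 2 * t ^ p + c * n * t ^ q) := by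
  have hcont := continuous_exp_rpow_add_rpow a c n hp hq
  calc s * Real.exp (-a * n ^ 2 * s ^ p - |c| * n * s ^ q)
      = ∫ _ in (0 : ℝ)..s, Real.exp (-a * n ^ 2 * s ^ p - |c| * n * s ^ q) := by simp
    _ ≤ ∫ t in (0 : ℝ)..s, Real.exp (-a * n ^ 2 * t ^ p + c * n * t ^ q) := by
        refine intervalIntegral.integral_mono_on hs.le (by simp)
          (hcont.intervalIntegrable _ _) fun t ht => Real.exp_le_exp.2 ?_
        have h1 : a * n ^ 2 * t ^ p ≤ a * n ^ 2 * s ^ p := by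
          gcongr
          exacts [ht.1, ht.2]
        have h2 : |c| * n * t ^ q ≤ |c| * n * s ^ q := by
          gcongr
          exacts [ht.1, ht.2]
        have h3 : -|c| * (n * t ^ q) ≤ c * (n * t ^ q) :=
          mul_le_mul_of_nonneg_right (neg_abs_le c) (mul_nonneg hn (Real.rpow_nonneg ht.1 q))
        linarith
    _ ≤ ∫ t in (0 : ℝ)..ε, Real.exp (-a * n ^ 2 * t ^ p + c * n * t ^ q) :=
        intervalIntegral.integral_mono_interval le_rfl hs.le hsε
          (Eventually.of_forall fun t => (Real.exp_pos _).le) (hcont.intervalIntegrable _ _)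

/-- Upper bound for the integral, when the quadratic term dominates beyond `s`. -/
theorem integral_exp_rpow_le_mul_exp {a p q c ε n s : ℝ} (ha : 0 < a) (hp : 0 < p) (hq : 0 < q)
    (hε : 0 < ε) (hn : 0 ≤ n) (hs : 0 < s) (hdom : |c| * ε ^ q ≤ a * (n * s ^ p)) :
    ∫ t in (0 : ℝ)..ε, Real.exp (-a * n ^ 2 * t ^ p + c * n * t ^ q) ≤
      ε * Real.exp (|c| * n * s ^ q) := by
  have hcont := continuous_exp_rpow_add_rpow a c n hp hq
  calc ∫ t in (0 : ℝ)..ε, Real.exp (-a * n ^ 2 * t ^ p + c * n * t ^ q)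
      ≤ ∫ _ in (0 : ℝ)..ε, Real.exp (|c| * n * s ^ q) := by
        refine intervalIntegral.integral_mono_on hε.le (hcont.intervalIntegrable _ _) (by simp)
          fun t ht => Real.exp_le_exp.2 ?_
        have h3 : c * (n * t ^ q) ≤ |c| * (n * t ^ q) :=
          mul_le_mul_of_nonneg_right (le_abs_self c) (mul_nonneg hn (Real.rpow_nonneg ht.1 q))
        rcases le_total t s with hts | hst
        · have h1 : 0 ≤ a * n ^ 2 * t ^ p :=
            mul_nonneg (by positivity) (Real.rpow_nonneg ht.1 p)
          have h2 : |c| * n * t ^ q ≤ |c| * n * s ^ q := by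
            gcongr
            exact ht.1
          linarith
        · have h1 : a * n ^ 2 * s ^ p ≤ a * n ^ 2 * t ^ p := by gcongr
          have h2 : |c| * n * t ^ q ≤ |c| * n * ε ^ q := by
            gcongr
            exacts [ht.1, ht.2]
          have h4 : 0 ≤ |c| * n * s ^ q := by positivity
          have h5 := mul_le_mul_of_nonneg_left hdom hn
          linarith
    _ = ε * Real.exp (|c| * n * s ^ q) := by simp

/-- Proposition 6.1: the boundary integral `I(N) = ∫₀^ε exp(−a N² t^p + c N t^q) dt`
grows at most sub-exponentially in `N`: `(1/N) log I(N) → 0`. -/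
theorem subexponential_growth_of_boundary_integral
    (a p q c ε : ℝ) (ha : 0 < a) (hp : 0 < p) (hq : 0 < q) (hε : 0 < ε) :
    Tendsto
      (fun N : ℕ =>
        (1 / (N : ℝ)) *
          Real.log (∫ t in (0:ℝ)..ε, Real.exp (-a * (N : ℝ)^2 * t ^ p + c * (N : ℝ) * t ^ q)))
      atTop (nhds 0) := by
  suffices h : Tendsto (fun x : ℝ => (1 / x) *
      Real.log (∫ t in (0:ℝ)..ε, Real.exp (-a * x ^ 2 * t ^ p + c * x * t ^ q)))
      atTop (nhds 0) from h.comp tendsto_natCast_atTop_atTop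
  have hinv (b : ℝ) : Tendsto (fun x : ℝ => b / x) atTop (nhds 0) :=
    tendsto_const_nhds.div_atTop tendsto_id
  have hlog : Tendsto (fun x : ℝ => Real.log x / x) atTop (nhds 0) :=
    Real.isLittleO_log_id_atTop.tendsto_div_nhds_zero
  have hpow {r : ℝ} (hr : 0 < r) : Tendsto (fun x : ℝ => |c| * (x ^ (-r)) ^ q) atTop (nhds 0) := by
    simpa [Real.zero_rpow hq.ne'] using
      ((tendsto_rpow_neg_atTop hr).rpow_const (Or.inr hq.le)).const_mul |c|
  have hlow : Tendsto (fun x : ℝ => -(2 / p) * (Real.log x / x) - a / x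
      - |c| * (x ^ (-(2 / p))) ^ q) atTop (nhds 0) := by
    simpa using ((hlog.const_mul (-(2 / p))).sub (hinv a)).sub (hpow (r := 2 / p) (by positivity))
  have hupp : Tendsto (fun x : ℝ => Real.log ε / x + |c| * (x ^ (-(1 / (2 * p)))) ^ q)
      atTop (nhds 0) := by
    simpa using (hinv (Real.log ε)).add (hpow (r := 1 / (2 * p)) (by positivity))
  have hsmall : ∀ᶠ x : ℝ in atTop, x ^ (-(2 / p)) ≤ ε :=
    (tendsto_rpow_neg_atTop (by positivity)).eventually_le_const hε
  have hdom : ∀ᶠ x : ℝ in atTop, |c| * ε ^ q ≤ a * x ^ (1 / 2 : ℝ) :=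
    ((tendsto_rpow_atTop (by norm_num)).const_mul_atTop ha).eventually_ge_atTop _
  refine tendsto_of_tendsto_of_tendsto_of_le_of_le' hlow hupp ?_ ?_
  · filter_upwards [hsmall, eventually_gt_atTop 0] with x hx hx0
    have hs : 0 < x ^ (-(2 / p)) := by positivity
    have hle := Real.log_le_log (by positivity)
      (mul_exp_le_integral_exp_rpow (c := c) ha hp hq hx0.le hs hx)
    have hsp : x ^ 2 * (x ^ (-(2 / p))) ^ p = 1 := by
      rw [← Real.rpow_mul hx0.le, show -(2 / p) * p = -2 by field_simp, Real.rpow_neg hx0.le,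
        Real.rpow_two]
      field_simp
    rw [Real.log_mul hs.ne' (Real.exp_ne_zero _), Real.log_exp, Real.log_rpow hx0,
      mul_assoc (-a), hsp] at hle
    refine le_trans (le_of_eq ?_) (mul_le_mul_of_nonneg_left hle (one_div_pos.2 hx0).le)
    field_simp
    ring
  · filter_upwards [hdom, eventually_gt_atTop 0] with x hx hx0
    have hs : 0 < x ^ (-(1 / (2 * p))) := by positivity
    have hsp : x * (x ^ (-(1 / (2 * p)))) ^ p = x ^ (1 / 2 : ℝ) := by
      rw [← Real.rpow_mul hx0.le, ← Real.rpow_one_add' hx0.le] <;>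
        rw [show -(1 / (2 * p)) * p = -(1 / 2) by field_simp] <;> norm_num
    have hpos : 0 < ∫ t in (0:ℝ)..ε, Real.exp (-a * x ^ 2 * t ^ p + c * x * t ^ q) :=
      intervalIntegral.intervalIntegral_pos_of_pos
        ((continuous_exp_rpow_add_rpow a c x hp hq).intervalIntegrable _ _)
        (fun t => Real.exp_pos _) hε
    have hle := Real.log_le_log hpos
      (integral_exp_rpow_le_mul_exp (c := c) ha hp hq hε hx0.le hs (by rwa [hsp]))
    rw [Real.log_mul hε.ne' (Real.exp_ne_zero _), Real.log_exp] at hle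
    refine (mul_le_mul_of_nonneg_left hle (one_div_pos.2 hx0).le).trans_eq ?_
    field_simp
end

section
/- Let 0 < τ < 1, r > 0 and x > 0, and let I(x; r, τ) = ∫₀^{2π} dΘ / (x − (1+τ)·r·cos Θ − i·(1−τ)·r·sin Θ), a complex-valued integral. If x > r(1+τ) then I(x; r, τ) = 2π/√(x² − 4τr²), and if 0 < x < r(1+τ) then I(x; r, τ) = 0. -/
open Real MeasureTheory Filter

/-- Integrating `θ ↦ e^{iθ} f(e^{iθ})` over a period amounts to a contour integral of `f` over the
unit circle. -/
lemma integral_circleMap_mul_eq_circleIntegral (f : ℂ → ℂ) :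
    (∫ θ in (0:ℝ)..(2*Real.pi), circleMap 0 1 θ * f (circleMap 0 1 θ))
      = -Complex.I * ∮ z in C(0, 1), f z := by
  rw [circleIntegral, ← intervalIntegral.integral_const_mul]
  refine intervalIntegral.integral_congr fun θ _ => ?_
  simp only [deriv_circleMap, smul_eq_mul]
  linear_combination (circleMap 0 1 θ * f (circleMap 0 1 θ)) * Complex.I_mul_I

lemma circleMap_zero_one_eq_cos_add_sin (θ : ℝ) :
    circleMap 0 1 θ = Complex.cos θ + Complex.sin θ * Complex.I := by
  simp [circleMap, Complex.exp_mul_I]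

lemma elliptic_denominator_inv_eq (τ r x θ : ℝ) :
    ((x : ℂ) - ((1+τ)*r*Real.cos θ : ℝ) - Complex.I * ((1-τ)*r*Real.sin θ : ℝ))⁻¹
      = circleMap 0 1 θ *
        (x * circleMap 0 1 θ - r * circleMap 0 1 θ ^ 2 - r * τ)⁻¹ := by
  have hne : circleMap 0 1 θ ≠ 0 := circleMap_ne_center one_ne_zero
  rw [← inv_inv (circleMap 0 1 θ), ← mul_inv, inv_inv]
  congr 1
  rw [eq_inv_mul_iff_mul_eq₀ hne, circleMap_zero_one_eq_cos_add_sin]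
  push_cast
  linear_combination (-(r : ℂ) * τ) * Complex.sin_sq_add_cos_sq (θ : ℂ)
    + (r : ℂ) * τ * Complex.sin θ ^ 2 * Complex.I_sq

lemma elliptic_denominator_inv_reflect_eq (τ r x θ : ℝ) :
    ((x : ℂ) - ((1+τ)*r*Real.cos (2*Real.pi - θ) : ℝ)
        - Complex.I * ((1-τ)*r*Real.sin (2*Real.pi - θ) : ℝ))⁻¹
      = circleMap 0 1 θ *
        (x * circleMap 0 1 θ - r - r * τ * circleMap 0 1 θ ^ 2)⁻¹ := by
  have hne : circleMap 0 1 θ ≠ 0 := circleMap_ne_center one_ne_zero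
  rw [← inv_inv (circleMap 0 1 θ), ← mul_inv, inv_inv]
  congr 1
  rw [eq_inv_mul_iff_mul_eq₀ hne, circleMap_zero_one_eq_cos_add_sin, Real.cos_two_pi_sub,
    Real.sin_two_pi_sub]
  push_cast
  linear_combination (-(r : ℂ)) * Complex.sin_sq_add_cos_sq (θ : ℂ)
    + (r : ℂ) * Complex.sin θ ^ 2 * Complex.I_sq

lemma reversed_quadratic_ne_zero_of_norm_le_one {τ r x : ℝ} (hτ0 : 0 < τ) (hτ1 : τ < 1)
    (hr : 0 < r) (hx : 0 < x) (hxr : x < r * (1+τ)) {u : ℂ} (hu : ‖u‖ ≤ 1) :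
    (x : ℂ) * u - r - r * τ * u ^ 2 ≠ 0 := by
  intro h
  have hn : u.re ^ 2 + u.im ^ 2 ≤ 1 := by
    have hsq := Complex.sq_norm u
    rw [Complex.normSq_apply] at hsq
    nlinarith [norm_nonneg u]
  have hre : x * u.re - r - r * τ * (u.re ^ 2 - u.im ^ 2) = 0 := by
    have := congrArg Complex.re h
    simp [pow_two] at this
    linarith
  have him : u.im * (x - 2 * r * τ * u.re) = 0 := by
    have := congrArg Complex.im h
    simp [pow_two] at this
    linarith
  rcases mul_eq_zero.mp him with hb | hb
  · rw [hb] at hre hn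
    have ha1 : u.re ≤ 1 := by nlinarith
    have hpos : 0 < u.re := by
      by_contra! hle
      nlinarith [mul_nonneg (mul_pos hr hτ0).le (sq_nonneg u.re),
        mul_nonneg hx.le (neg_nonneg.mpr hle)]
    have h1 : 0 ≤ r * ((1 - u.re) * (1 - τ * u.re)) :=
      mul_nonneg hr.le (mul_nonneg (by linarith) (by nlinarith))
    nlinarith [mul_pos hpos (sub_pos.mpr hxr)]
  · have h1 : 0 < r * (1 - τ * (u.re ^ 2 + u.im ^ 2)) := mul_pos hr (by nlinarith)
    have h2 : x = 2 * r * τ * u.re := by linarith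
    rw [h2] at hre
    nlinarith

/-- Cauchy's formula for the reciprocal of a quadratic with exactly one root in the unit disc. -/
lemma circleIntegral_inv_quadratic {c a b : ℂ} (ha : ‖a‖ < 1) (hb : 1 < ‖b‖) :
    (∮ z in C(0, 1), (c * ((z - a) * (z - b)))⁻¹)
      = 2 * Real.pi * Complex.I * (c * (a - b))⁻¹ := by
  rcases eq_or_ne c 0 with rfl | hc
  · simp [circleIntegral]
  have hd : DifferentiableOn ℂ (fun z => (c * (z - b))⁻¹) (Metric.closedBall 0 1) := by
    refine DifferentiableOn.inv (by fun_prop) fun z hz => mul_ne_zero hc (sub_ne_zero.mpr ?_)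
    rintro rfl
    exact absurd (mem_closedBall_zero_iff.mp hz) (not_le.mpr hb)
  have h := hd.circleIntegral_sub_inv_smul (mem_ball_zero_iff.mpr ha)
  simp only [smul_eq_mul] at h
  rw [← h]
  congr 1
  funext z
  simp only [mul_inv]
  ring

/-- The angular integral `I(x; r, τ) = ∫₀^{2π} dΘ / (x − (1+τ)r cosΘ − i(1−τ)r sinΘ)`
equals `2π/√(x² − 4τr²)` when `x > r(1+τ)` and `0` when `0 < x < r(1+τ)`. -/
theorem angular_integral_elliptic_law
    (τ r x : ℝ) (hτ0 : 0 < τ) (hτ1 : τ < 1) (hr : 0 < r) (hx : 0 < x) :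
    (r * (1+τ) < x →
      (∫ Θ in (0:ℝ)..(2*Real.pi),
          ((x : ℂ) - ((1+τ)*r*Real.cos Θ : ℝ) - Complex.I * ((1-τ)*r*Real.sin Θ : ℝ))⁻¹)
        = ((2*Real.pi / Real.sqrt (x^2 - 4*τ*r^2) : ℝ) : ℂ)) ∧
    (x < r * (1+τ) →
      (∫ Θ in (0:ℝ)..(2*Real.pi),
          ((x : ℂ) - ((1+τ)*r*Real.cos Θ : ℝ) - Complex.I * ((1-τ)*r*Real.sin Θ : ℝ))⁻¹)
        = 0) := by
  constructor
  · intro hxr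
    have hD : 0 < x^2 - 4*τ*r^2 := by
      nlinarith [mul_pos hr (show 0 < 1 + τ by linarith), sq_nonneg (r * (1 - τ))]
    set s := Real.sqrt (x^2 - 4*τ*r^2) with hs
    have hs0 : 0 < s := Real.sqrt_pos.mpr hD
    have hs2 : s ^ 2 = x^2 - 4*τ*r^2 := Real.sq_sqrt hD.le
    have hsx : s < x := by nlinarith [mul_pos hτ0 (pow_pos hr 2)]
    have ha : (x - s) / (2 * r) < 1 := by
      rw [div_lt_one (by linarith)]
      by_contra! hle
      nlinarith [mul_pos hr (sub_pos.mpr hxr)]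
    have hb : 1 < (x + s) / (2 * r) := by
      rw [one_lt_div (by linarith)]
      by_contra! hle
      nlinarith [mul_pos hr (sub_pos.mpr hxr)]
    have ha' : ‖(((x - s) / (2 * r) : ℝ) : ℂ)‖ < 1 := by
      rwa [Complex.norm_real, Real.norm_of_nonneg (div_nonneg (by linarith) (by linarith))]
    have hb' : 1 < ‖(((x + s) / (2 * r) : ℝ) : ℂ)‖ := by
      rwa [Complex.norm_real, Real.norm_of_nonneg (div_nonneg (by linarith) (by linarith))]
    have hrC : (r : ℂ) ≠ 0 := by exact_mod_cast hr.ne'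
    have hsC : (s : ℂ) ≠ 0 := by exact_mod_cast hs0.ne'
    have hs2C : (s : ℂ) ^ 2 = x^2 - 4*τ*r^2 := by exact_mod_cast hs2
    have hfactor (z : ℂ) : (x : ℂ) * z - r * z ^ 2 - r * τ
        = -r * ((z - ((x - s) / (2 * r) : ℝ)) * (z - ((x + s) / (2 * r) : ℝ))) := by
      push_cast
      field_simp
      linear_combination -hs2C
    simp_rw [elliptic_denominator_inv_eq]
    rw [integral_circleMap_mul_eq_circleIntegral (fun z => (x * z - r * z ^ 2 - r * τ)⁻¹)]
    simp_rw [hfactor]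
    rw [circleIntegral_inv_quadratic ha' hb']
    have hdiff : -(r : ℂ) * ((((x - s) / (2 * r) : ℝ) : ℂ) - ((x + s) / (2 * r) : ℝ)) = s := by
      push_cast
      field_simp
      ring
    rw [hdiff]
    push_cast
    linear_combination (-2 * Real.pi * (s : ℂ)⁻¹) * Complex.I_sq
  · intro hxr
    have hreflect := intervalIntegral.integral_comp_sub_left (a := 0) (b := 2*Real.pi)
      (fun Θ : ℝ => ((x : ℂ) - ((1+τ)*r*Real.cos Θ : ℝ)
        - Complex.I * ((1-τ)*r*Real.sin Θ : ℝ))⁻¹) (2*Real.pi)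
    rw [sub_self, sub_zero] at hreflect
    rw [← hreflect]
    simp_rw [elliptic_denominator_inv_reflect_eq]
    rw [integral_circleMap_mul_eq_circleIntegral (fun u => (x * u - r - r * τ * u ^ 2)⁻¹)]
    have hd : DifferentiableOn ℂ (fun u : ℂ => ((x : ℂ) * u - r - r * τ * u ^ 2)⁻¹)
        (Metric.closedBall 0 1) :=
      DifferentiableOn.inv (by fun_prop) fun u hu =>
        reversed_quadratic_ne_zero_of_norm_le_one hτ0 hτ1 hr hx hxr (mem_closedBall_zero_iff.mp hu)
    rw [Complex.circleIntegral_eq_zero_of_differentiable_on_off_countable zero_le_one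
      Set.countable_empty hd.continuousOn fun z hz =>
        hd.differentiableAt (Metric.closedBall_mem_nhds_of_mem hz.1), mul_zero]
end

section
/- Let 0 < τ < 1 and 0 < m < 1, and define Σ_eq : ℝ → ℝ by Σ_eq(x) = Φ(x) − (x−m)²/(2τ) − log m, where Φ(x) = x²/(2(1+τ)) − 1/2 for |x| ≤ 1+τ and Φ(x) = (1/(8τ))(|x| − √(x²−4τ))² + log((|x| + √(x²−4τ))/2) for |x| ≥ 1+τ. Then Σ_eq attains a strict global maximum at x* = (1+τ)m; that is, Σ_eq(x*) = (m² − 1)/2 − log m, and Σ_eq(x) < (m² − 1)/2 − log m for every real x ≠ x*. -/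
open Real MeasureTheory Filter

/-- Closed form of the logarithmic potential of the elliptic law at a real point. -/
noncomputable def PhiEq (τ x : ℝ) : ℝ :=
  if |x| ≤ 1 + τ then x^2 / (2*(1+τ)) - 1/2
  else (1/(8*τ)) * (|x| - Real.sqrt (x^2 - 4*τ))^2
        + Real.log ((|x| + Real.sqrt (x^2 - 4*τ)) / 2)

/-- The exponent in the Kac–Rice integral for the mean total number of equilibria. -/
noncomputable def SigmaEq (τ m x : ℝ) : ℝ :=
  PhiEq τ x - (x - m)^2 / (2*τ) - Real.log m

/-- On `[1, ∞)` the logarithm is bounded by `(z - 1/z)/2`, i.e. `log z ≤ sinh (log z)`. -/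
lemma log_le_half_sub_inv {z : ℝ} (hz : 1 ≤ z) : Real.log z ≤ (z - z⁻¹) / 2 := by
  rw [← Real.sinh_log (by linarith)]
  exact Real.self_le_sinh_iff.2 (Real.log_nonneg hz)

/-- In the inner regime the deficit from the maximum is an explicit square. -/
lemma sigmaEq_of_abs_le {τ m x : ℝ} (hτ : 0 < τ) (hx : |x| ≤ 1 + τ) :
    SigmaEq τ m x =
      (m^2 - 1)/2 - Real.log m - (x - (1+τ)*m)^2 / (2*τ*(1+τ)) := by
  have h : 1 + τ ≠ 0 := by positivity
  rw [SigmaEq, PhiEq, if_pos hx]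
  field_simp
  ring

/-- The strict bound in the outer regime, in the coordinate `z` with `|x| = z + τ/z`. -/
lemma outer_exponent_lt {τ m z : ℝ} (hτ0 : 0 < τ) (hτ1 : τ < 1) (hm1 : m < 1) (hz : 1 < z)
    (ha : 1 + τ < z + τ / z) :
    (τ / z)^2 / (2*τ) + Real.log z - (z + τ / z - m)^2 / (2*τ) < (m^2 - 1)/2 := by
  have hz0 : 0 < z := by linarith
  have hlog := log_le_half_sub_inv hz.le
  have hm : 0 < (1 - m) * (2 * (z + τ / z) - (1 + τ) * (1 + m)) :=
    mul_pos (by linarith) (by nlinarith)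
  have hz' : (z - 1)^2 * (τ / z - 1) ≤ 0 := by
    have : τ / z ≤ 1 := (div_le_one hz0).2 (by linarith)
    exact mul_nonpos_of_nonneg_of_nonpos (sq_nonneg _) (by linarith)
  have key : (τ / z)^2 / (2*τ) + (z - z⁻¹) / 2 - (z + τ / z - m)^2 / (2*τ) - (m^2 - 1)/2
      = ((z - 1)^2 * (τ / z - 1)
          - (1 - m) * (2 * (z + τ / z) - (1 + τ) * (1 + m))) / (2*τ) := by
    field_simp
    ring
  have := div_neg_of_neg_of_pos (sub_neg.2 (hz'.trans_lt hm)) (by positivity : 0 < 2*τ)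
  linarith

/-- The outer regime stays strictly below the maximum. -/
lemma sigmaEq_lt_of_lt_abs {τ m x : ℝ} (hτ0 : 0 < τ) (hτ1 : τ < 1) (hm0 : 0 < m) (hm1 : m < 1)
    (hx : 1 + τ < |x|) : SigmaEq τ m x < (m^2 - 1)/2 - Real.log m := by
  have hdisc : (1 - τ)^2 < x^2 - 4*τ := by nlinarith [sq_abs x]
  have hs : 1 - τ < √(x^2 - 4*τ) := Real.lt_sqrt_of_sq_lt hdisc
  have hsq : √(x^2 - 4*τ)^2 = |x|^2 - 4*τ := by
    rw [Real.sq_sqrt ((sq_nonneg _).trans hdisc.le), sq_abs]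
  rw [SigmaEq, PhiEq, if_neg hx.not_ge]
  set s := √(x^2 - 4*τ)
  have hz : 1 < (|x| + s) / 2 := by linarith
  have hw : τ / ((|x| + s) / 2) = (|x| - s) / 2 := by
    rw [div_eq_iff (by linarith)]
    linarith
  have hsum : (|x| + s) / 2 + (|x| - s) / 2 = |x| := by ring
  have hout := outer_exponent_lt hτ0 hτ1 hm1 hz (by rwa [hw, hsum])
  rw [hw, hsum] at hout
  have hsign : (|x| - m)^2 / (2*τ) ≤ (x - m)^2 / (2*τ) := by
    gcongr ?_ / _
    nlinarith [sq_abs x, le_abs_self x]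
  have hcoef : 1 / (8*τ) * (|x| - s)^2 = ((|x| - s) / 2)^2 / (2*τ) := by
    field_simp
    ring
  linarith

/-- `Σ_eq` attains a strict global maximum at `x* = (1+τ)m`, with maximal value
`(m² − 1)/2 − log m`. -/
theorem sigmaEq_strict_global_max
    (τ m : ℝ) (hτ0 : 0 < τ) (hτ1 : τ < 1) (hm0 : 0 < m) (hm1 : m < 1) :
    SigmaEq τ m ((1+τ)*m) = (m^2 - 1)/2 - Real.log m ∧
    ∀ x : ℝ, x ≠ (1+τ)*m → SigmaEq τ m x < (m^2 - 1)/2 - Real.log m := by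
  have hmem : |(1+τ)*m| ≤ 1 + τ := by
    rw [abs_of_pos (by positivity)]
    nlinarith
  refine ⟨by simp [sigmaEq_of_abs_le hτ0 hmem], fun x hx => ?_⟩
  rcases le_or_gt |x| (1 + τ) with h | h
  · rw [sigmaEq_of_abs_le hτ0 h]
    have : 0 < (x - (1+τ)*m)^2 := sq_pos_of_ne_zero (sub_ne_zero.2 hx)
    have : 0 < (x - (1+τ)*m)^2 / (2*τ*(1+τ)) := by positivity
    linarith
  · exact sigmaEq_lt_of_lt_abs hτ0 hτ1 hm0 hm1 h
end

section
/- Let 0 < τ < 1 and 0 < m < 1, and define Σ_eq : ℝ → ℝ by Σ_eq(x) = Φ(x) − (x−m)²/(2τ) − log m, where Φ(x) = x²/(2(1+τ)) − 1/2 for |x| ≤ 1+τ and Φ(x) = (1/(8τ))(|x| − √(x²−4τ))² + log((|x| + √(x²−4τ))/2) for |x| ≥ 1+τ. Then Σ_eq is strictly decreasing on the interval [1+τ, ∞) and strictly increasing on the interval (−∞, −(1+τ)]. -/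
open Real MeasureTheory Filter

lemma phiEq_neg (τ x : ℝ) : PhiEq τ (-x) = PhiEq τ x := by
  simp [PhiEq]

lemma one_sub_le_sqrt {τ x : ℝ} (hτ0 : 0 < τ) (hx : 1 + τ ≤ x) :
    1 - τ ≤ √(x ^ 2 - 4 * τ) :=
  Real.le_sqrt_of_sq_le (by nlinarith)

/-- The two branches of `PhiEq` agree at `1 + τ`, so the outer one is valid on `[1 + τ, ∞)`. -/
lemma phiEq_of_le {τ x : ℝ} (hτ0 : 0 < τ) (hτ1 : τ < 1) (hx : 1 + τ ≤ x) :
    PhiEq τ x = (1 / (8 * τ)) * (x - √(x ^ 2 - 4 * τ)) ^ 2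
      + Real.log ((x + √(x ^ 2 - 4 * τ)) / 2) := by
  have hx0 : |x| = x := abs_of_nonneg (by linarith)
  unfold PhiEq
  rw [hx0]
  split_ifs with h
  · obtain rfl : x = 1 + τ := le_antisymm h hx
    have hs : √((1 + τ) ^ 2 - 4 * τ) = 1 - τ := by
      rw [show (1 + τ) ^ 2 - 4 * τ = (1 - τ) ^ 2 by ring]
      exact Real.sqrt_sq (by linarith)
    rw [hs, show (1 + τ + (1 - τ)) / 2 = 1 by ring, Real.log_one]
    field_simp
    ring
  · rfl

lemma hasDerivAt_phiEq_outer {τ x : ℝ} (hτ0 : 0 < τ) (hτ1 : τ < 1) (hx : 1 + τ ≤ x) :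
    HasDerivAt (fun y : ℝ => (1 / (8 * τ)) * (y - √(y ^ 2 - 4 * τ)) ^ 2
      + Real.log ((y + √(y ^ 2 - 4 * τ)) / 2)) ((x - √(x ^ 2 - 4 * τ)) / (2 * τ)) x := by
  have hs := one_sub_le_sqrt hτ0 hx
  have hs0 : 0 < √(x ^ 2 - 4 * τ) := by linarith
  have hpos : 0 < x ^ 2 - 4 * τ := Real.sqrt_pos.mp hs0
  have hsq : √(x ^ 2 - 4 * τ) ^ 2 = x ^ 2 - 4 * τ := Real.sq_sqrt hpos.le
  have hroot := (((hasDerivAt_id x).pow 2).sub_const (4 * τ)).sqrt hpos.ne'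
  have hsum : 0 < x + √(x ^ 2 - 4 * τ) := by linarith
  have h := ((((hasDerivAt_id x).sub hroot).pow 2).const_mul (1 / (8 * τ))).add
    ((((hasDerivAt_id x).add hroot).div_const 2).log (by simpa using hsum.ne'))
  refine h.congr_deriv ?_
  simp only [id, Pi.add_apply, Pi.sub_apply, Pi.pow_apply]
  generalize √(x ^ 2 - 4 * τ) = s at *
  have hs' := hs0.ne'
  have hsum' := hsum.ne'
  field_simp
  push_cast
  have hτ : τ = (x ^ 2 - s ^ 2) / 4 := by linarith
  rw [hτ]
  ring

/-- The derivative is `(2c - x - √(x² - 4τ)) / (2τ) ≤ (c - 1) / τ < 0`. -/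
lemma strictAntiOn_phiEq_sub {τ c : ℝ} (hτ0 : 0 < τ) (hτ1 : τ < 1) (hc : c < 1) :
    StrictAntiOn (fun x => PhiEq τ x - (x - c) ^ 2 / (2 * τ)) (Set.Ici (1 + τ)) := by
  have hderiv : ∀ x ∈ Set.Ici (1 + τ), HasDerivAt
      (fun y : ℝ => (1 / (8 * τ)) * (y - √(y ^ 2 - 4 * τ)) ^ 2
        + Real.log ((y + √(y ^ 2 - 4 * τ)) / 2) - (y - c) ^ 2 / (2 * τ))
      ((2 * c - x - √(x ^ 2 - 4 * τ)) / (2 * τ)) x := by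
    intro x hx
    refine ((hasDerivAt_phiEq_outer hτ0 hτ1 hx).sub
      ((((hasDerivAt_id x).sub_const c).pow 2).div_const (2 * τ))).congr_deriv ?_
    simp only [id]
    push_cast
    ring
  refine StrictAntiOn.congr (strictAntiOn_of_deriv_neg (convex_Ici _)
    (fun x hx => (hderiv x hx).continuousAt.continuousWithinAt) fun x hx => ?_)
    fun x hx => by simp only [phiEq_of_le hτ0 hτ1 hx]
  have hx' : 1 + τ ≤ x := interior_subset hx
  rw [(hderiv x hx').deriv]
  have := one_sub_le_sqrt hτ0 hx'
  exact div_neg_of_neg_of_pos (by linarith) (by linarith)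

/-- `Σ_eq` is strictly decreasing on `[1+τ, ∞)` and strictly increasing on
`(−∞, −(1+τ)]`. -/
theorem sigmaEq_monotone_outside
    (τ m : ℝ) (hτ0 : 0 < τ) (hτ1 : τ < 1) (hm0 : 0 < m) (hm1 : m < 1) :
    StrictAntiOn (SigmaEq τ m) (Set.Ici (1+τ)) ∧
    StrictMonoOn (SigmaEq τ m) (Set.Iic (-(1+τ))) := by
  constructor
  · intro x hx y hy hxy
    exact sub_lt_sub_right (strictAntiOn_phiEq_sub hτ0 hτ1 hm1 hx hy hxy) _
  · intro x hx y hy hxy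
    have h := strictAntiOn_phiEq_sub hτ0 hτ1 (c := -m) (by linarith)
      (Set.mem_Ici.mpr (le_neg_of_le_neg hy)) (Set.mem_Ici.mpr (le_neg_of_le_neg hx))
      (neg_lt_neg hxy)
    have hsq : ∀ z : ℝ, (-z - -m) ^ 2 = (z - m) ^ 2 := fun z => by ring
    simp only [phiEq_neg, hsq] at h
    exact sub_lt_sub_right h _
end

section
/- Let 0 < τ < 1 and define Ψ : [1+τ, ∞) → ℝ by Ψ(x) = −1/2 + x²/(2(1+τ)) − (1/(8τ))·(x − √(x² − 4τ))² − log((x + √(x² − 4τ))/2). Then lim_{ε → 0⁺} Ψ((1+τ)(1+ε))/ε² = (1+τ)/(1−τ). -/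
open Real MeasureTheory Filter

/-- The large deviation rate function for the right tail of `x_max` in the real
elliptic ensemble. -/
noncomputable def PsiR (τ x : ℝ) : ℝ :=
  -1/2 + x^2 / (2*(1+τ)) - (1/(8*τ)) * (x - Real.sqrt (x^2 - 4*τ))^2
    - Real.log ((x + Real.sqrt (x^2 - 4*τ)) / 2)

/-- The square root in `PsiR` has argument bounded below by a positive constant beyond the
spectral edge. -/
lemma psiR_radicand_pos {τ x : ℝ} (hτ0 : 0 < τ) (hτ1 : τ < 1) (hx : 1 + τ ≤ x) :
    0 < x^2 - 4*τ := by
  nlinarith [mul_pos (sub_pos.2 hτ1) (sub_pos.2 hτ1)]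

lemma sqrt_psiR_radicand_edge {τ : ℝ} (hτ1 : τ < 1) :
    Real.sqrt ((1+τ)^2 - 4*τ) = 1 - τ := by
  rw [show (1+τ)^2 - 4*τ = (1-τ)^2 by ring, Real.sqrt_sq (by linarith)]

lemma hasDerivAt_sqrt_sq_sub {τ x : ℝ} (h : 0 < x^2 - 4*τ) :
    HasDerivAt (fun y : ℝ => Real.sqrt (y^2 - 4*τ)) (x / Real.sqrt (x^2 - 4*τ)) x := by
  have h1 : HasDerivAt (fun y : ℝ => y^2 - 4*τ) (2*x) x := by
    simpa using (hasDerivAt_pow 2 x).sub_const (4*τ)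
  convert h1.sqrt h.ne' using 1
  rw [mul_div_mul_left _ _ two_ne_zero]

lemma psiR_edge {τ : ℝ} (hτ0 : 0 < τ) (hτ1 : τ < 1) : PsiR τ (1+τ) = 0 := by
  rw [PsiR, sqrt_psiR_radicand_edge hτ1, show (1 + τ + (1 - τ)) / 2 = 1 by ring, Real.log_one]
  field_simp
  ring

lemma hasDerivAt_psiR {τ x : ℝ} (hτ0 : 0 < τ) (hτ1 : τ < 1) (hx : 1 + τ ≤ x) :
    HasDerivAt (PsiR τ) (x / (1+τ) - (x - Real.sqrt (x^2 - 4*τ)) / (2*τ)) x := by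
  have hr := psiR_radicand_pos hτ0 hτ1 hx
  have hs := hasDerivAt_sqrt_sq_sub hr
  have hsp := Real.sqrt_pos.2 hr
  have hsq := Real.sq_sqrt hr.le
  have hid := hasDerivAt_id' x
  have hlog := ((hid.add hs).div_const 2).log
    (ne_of_gt (show 0 < (x + Real.sqrt (x^2 - 4*τ)) / 2 by linarith))
  have H := ((((hid.pow 2).div_const (2*(1+τ))).const_add (-1/2)).sub
    (((hid.sub hs).pow 2).const_mul (1/(8*τ)))).sub hlog
  refine H.congr_deriv ?_
  simp only [Pi.add_apply, Pi.sub_apply]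
  set s := Real.sqrt (x^2 - 4*τ)
  have hxs : x + s ≠ 0 := by linarith
  have h1 : 1 + τ ≠ 0 := by linarith
  have hlog' : (1 + x / s) / 2 / ((x + s) / 2) = 1 / s := by
    field_simp
    ring
  have hmid : 1 / (8*τ) * (2 * (x - s) * (1 - x / s)) + 1 / s = (x - s) / (2*τ) := by
    field_simp
    linear_combination 4 * hsq
  have hx2 : 2 * x / (2 * (1 + τ)) = x / (1 + τ) := mul_div_mul_left _ _ two_ne_zero
  rw [hlog', ← hmid, ← hx2]
  norm_num
  ring

/-- Quadratic behavior of `Ψ^{(r)}` at the spectral edge: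
`Ψ((1+τ)(1+ε))/ε² → (1+τ)/(1−τ)` as `ε → 0⁺`. -/
theorem psiR_quadratic_at_edge
    (τ : ℝ) (hτ0 : 0 < τ) (hτ1 : τ < 1) :
    Tendsto (fun ε : ℝ => PsiR τ ((1+τ)*(1+ε)) / ε^2)
      (nhdsWithin 0 (Set.Ioi 0)) (nhds ((1+τ)/(1-τ))) := by
  have hp : (0:ℝ) < 1 + τ := by linarith
  have hm : (0:ℝ) < 1 - τ := by linarith
  have hlin (ε : ℝ) : HasDerivAt (fun ε : ℝ => (1+τ)*(1+ε)) (1+τ) ε := by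
    simpa using ((hasDerivAt_id' ε).const_add 1).const_mul (1+τ)
  have hedge {ε : ℝ} (hε : 0 ≤ ε) : 1 + τ ≤ (1+τ)*(1+ε) := by nlinarith
  set d : ℝ → ℝ := fun x => x / (1+τ) - (x - Real.sqrt (x^2 - 4*τ)) / (2*τ) with hd
  have hf {ε : ℝ} (hε : 0 ≤ ε) : HasDerivAt (fun ε : ℝ => PsiR τ ((1+τ)*(1+ε)))
      (d ((1+τ)*(1+ε)) * (1+τ)) ε :=
    HasDerivAt.comp ε (hasDerivAt_psiR hτ0 hτ1 (hedge hε)) (hlin ε)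
  have hd0 : d (1+τ) = 0 := by
    simp only [hd, sqrt_psiR_radicand_edge hτ1]
    field_simp
    ring
  have hd' : HasDerivAt d (2 / ((1+τ)*(1-τ))) (1+τ) := by
    have hid := hasDerivAt_id' (1+τ)
    have hs := hasDerivAt_sqrt_sq_sub (psiR_radicand_pos hτ0 hτ1 le_rfl)
    rw [sqrt_psiR_radicand_edge hτ1] at hs
    refine ((hid.div_const (1+τ)).sub ((hid.sub hs).div_const (2*τ))).congr_deriv ?_
    field_simp
    ring
  have hg : HasDerivAt (fun ε : ℝ => d ((1+τ)*(1+ε))) (2 / ((1+τ)*(1-τ)) * (1+τ)) 0 := by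
    have h : HasDerivAt d (2 / ((1+τ)*(1-τ))) ((1+τ)*(1+0)) := by simpa using hd'
    exact HasDerivAt.comp (0:ℝ) h (hlin 0)
  refine HasDerivAt.lhopital_zero_nhdsGT (f' := fun ε => d ((1+τ)*(1+ε)) * (1+τ))
    (g' := fun ε => 2 * ε) ?_ ?_ ?_ ?_ ?_ ?_
  · filter_upwards [self_mem_nhdsWithin] with ε hε using hf (le_of_lt hε)
  · filter_upwards with ε
    simpa using hasDerivAt_pow 2 ε
  · filter_upwards [self_mem_nhdsWithin] with ε hε
    exact mul_ne_zero two_ne_zero (ne_of_gt hε)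
  · have h := (hf le_rfl).continuousAt.tendsto
    simp only [add_zero, mul_one, psiR_edge hτ0 hτ1] at h
    exact h.mono_left nhdsWithin_le_nhds
  · have h : Tendsto (fun ε : ℝ => ε^2) (nhds 0) (nhds (0^2)) := (continuous_pow 2).tendsto 0
    rw [zero_pow two_ne_zero] at h
    exact h.mono_left nhdsWithin_le_nhds
  · have h := (hg.tendsto_slope_zero_right).mul_const ((1+τ)/2)
    have hval : 2 / ((1+τ)*(1-τ)) * (1+τ) * ((1+τ)/2) = (1+τ)/(1-τ) := by
      field_simp
    rw [hval] at h
    refine h.congr fun ε => ?_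
    simp only [zero_add, add_zero, mul_one, hd0, sub_zero, smul_eq_mul]
    rw [mul_comm 2 ε, ← div_div, div_eq_inv_mul _ ε]
    ring
end

section
/- For a ≥ 0 and integer N ≥ 2 let G(N−1, a) = ∫_a^∞ e^{−t} t^{N−2} dt denote the upper incomplete gamma function, so that G(N−1, 0) = Γ(N−1). Then: (i) if 0 ≤ a < 1, lim_{N→∞} G(N−1, N·a)/Γ(N−1) = 1; (ii) if a = 1, lim_{N→∞} G(N−1, N)/Γ(N−1) = 1/2; (iii) if a > 1, lim_{N→∞} G(N−1, N·a)/Γ(N−1) = 0. -/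
open Real MeasureTheory Filter

/-- The upper incomplete gamma function `G(N−1, a) = ∫_a^∞ e^{−t} t^{N−2} dt`,
so that `G(N−1, 0) = Γ(N−1)` for `N ≥ 2`. -/
noncomputable def incGamma (N : ℕ) (a : ℝ) : ℝ :=
  ∫ t in Set.Ioi a, Real.exp (-t) * t ^ (N - 2)

/-- The density of the Gamma distribution of shape `n + 1`, recentred at `n`, rescaled by `√n` and
normalised to take the value `1` at its mode. -/
noncomputable def scaledGammaDensity (n : ℕ) (s : ℝ) : ℝ :=
  Real.exp (-(√n * s)) * (1 + s / √n) ^ n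

lemma log_one_add_le_of_nonneg {x : ℝ} (hx : 0 ≤ x) :
    Real.log (1 + x) ≤ x - x ^ 2 / (2 * (1 + x)) := by
  have h1 : 0 < 1 + x := by linarith
  have h := Real.self_le_sinh_iff.2 (Real.log_nonneg (by linarith : 1 ≤ 1 + x))
  rw [Real.sinh_log h1] at h
  refine h.trans (le_of_eq ?_)
  field_simp
  ring

lemma log_one_add_le_of_nonpos {x : ℝ} (hx : x ≤ 0) (h1 : -1 < x) :
    Real.log (1 + x) ≤ x - x ^ 2 / 2 := by
  have h := Real.hasSum_pow_div_log_of_abs_lt_one (x := -x) (by rw [abs_lt]; constructor <;> linarith)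
  have h2 := sum_le_hasSum (Finset.range 2) (fun i _ => by
    have : 0 ≤ -x := by linarith
    positivity) h
  norm_num [Finset.sum_range_succ] at h2
  linarith

lemma scaledGammaDensity_eq_exp {n : ℕ} {s : ℝ} (hn : 0 < n) (hs : -√n < s) :
    scaledGammaDensity n s = Real.exp (n * (Real.log (1 + s / √n) - s / √n)) := by
  have hr : 0 < √(n : ℝ) := by positivity
  have hx : 0 < 1 + s / √n := by
    have : -1 < s / √n := by rw [lt_div_iff₀ hr]; linarith
    linarith
  have e : (n : ℝ) * (s / √n) = √n * s := by
    have := Real.mul_self_sqrt (Nat.cast_nonneg (α := ℝ) n)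
    field_simp
    nlinarith
  rw [scaledGammaDensity, mul_sub, e, sub_eq_neg_add, Real.exp_add, Real.exp_nat_mul,
    Real.exp_log hx]

lemma scaledGammaDensity_le {n : ℕ} {s : ℝ} (hn : 0 < n) (hs : -√n < s) :
    scaledGammaDensity n s ≤ Real.exp (1 / 2 - 1 / 2 * |s|) := by
  rw [scaledGammaDensity_eq_exp hn hs, Real.exp_le_exp]
  have hr : 1 ≤ √(n : ℝ) := by
    rw [Real.one_le_sqrt]
    exact_mod_cast hn
  have hr0 : 0 < √(n : ℝ) := by positivity
  have hsq : (n : ℝ) * (s / √n) ^ 2 = s ^ 2 := by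
    rw [div_pow, Real.sq_sqrt (Nat.cast_nonneg n)]
    field_simp
  have hn0 : (0 : ℝ) ≤ n := Nat.cast_nonneg n
  rcases le_total 0 s with h | h
  · have hx : 0 ≤ s / √n := by positivity
    have hxs : s / √n ≤ s := div_le_self h hr
    have h1 := mul_le_mul_of_nonneg_left (log_one_add_le_of_nonneg hx) hn0
    have h2 : (n : ℝ) * ((s / √n) ^ 2 / (2 * (1 + s / √n))) = s ^ 2 / (2 * (1 + s / √n)) := by
      rw [← mul_div_assoc, hsq]
    have h3 : s ^ 2 / (2 * (1 + s)) ≤ s ^ 2 / (2 * (1 + s / √n)) := by gcongr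
    have h4 : (s - 1) / 2 ≤ s ^ 2 / (2 * (1 + s)) := by
      rw [le_div_iff₀ (by positivity)]
      nlinarith
    rw [abs_of_nonneg h]
    linarith
  · have hx : s / √n ≤ 0 := div_nonpos_of_nonpos_of_nonneg h hr0.le
    have hx1 : -1 < s / √n := by rw [lt_div_iff₀ hr0]; linarith
    have h1 := mul_le_mul_of_nonneg_left (log_one_add_le_of_nonpos hx hx1) hn0
    rw [abs_of_nonpos h]
    nlinarith [sq_nonneg (s + 1 / 2)]

lemma scaledGammaDensity_nonneg {n : ℕ} {s : ℝ} (hn : 0 < n) (hs : -√n < s) :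
    0 ≤ scaledGammaDensity n s := by
  rw [scaledGammaDensity_eq_exp hn hs]
  positivity

lemma tendsto_sqrt_natCast_atTop : Tendsto (fun n : ℕ => √(n : ℝ)) atTop atTop :=
  Real.tendsto_sqrt_atTop.comp tendsto_natCast_atTop_atTop

lemma tendsto_scaledGammaDensity (s : ℝ) :
    Tendsto (fun n : ℕ => scaledGammaDensity n s) atTop (nhds (Real.exp (-(1 / 2) * s ^ 2))) := by
  have hlim : Tendsto (fun n : ℕ => |s / √(n : ℝ)|) atTop (nhds 0) := by
    simpa using (tendsto_sqrt_natCast_atTop.const_div_atTop s).abs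
  have hbound : Tendsto (fun n : ℕ => s ^ 2 * (|s / √(n : ℝ)| / (1 - |s / √(n : ℝ)|)))
      atTop (nhds 0) := by
    simpa using (hlim.div (hlim.const_sub 1) (by norm_num)).const_mul (s ^ 2)
  have hexp : Tendsto (fun n : ℕ => (n : ℝ) * (Real.log (1 + s / √n) - s / √n)) atTop
      (nhds (-(1 / 2) * s ^ 2)) := by
    rw [tendsto_iff_dist_tendsto_zero]
    refine squeeze_zero' (Eventually.of_forall fun _ => dist_nonneg) ?_ hbound
    filter_upwards [hlim.eventually_lt_const one_pos, eventually_gt_atTop 0] with n hx hn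
    have hn' : (0 : ℝ) < n := by exact_mod_cast hn
    have hsq : (n : ℝ) * (s / √n) ^ 2 = s ^ 2 := by
      rw [div_pow, Real.sq_sqrt hn'.le]
      field_simp
    generalize s / √(n : ℝ) = x at *
    have h := Real.abs_log_sub_add_sum_range_le (x := -x) (by rwa [abs_neg]) 2
    norm_num [Finset.sum_range_succ] at h
    rw [Real.dist_eq, ← hsq]
    calc |(n : ℝ) * (Real.log (1 + x) - x) - -(1 / 2) * (n * x ^ 2)|
        = |(n : ℝ) * (-x + x ^ 2 / 2 + Real.log (1 + x))| := by ring_nf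
      _ = (n : ℝ) * |-x + x ^ 2 / 2 + Real.log (1 + x)| := by rw [abs_mul, abs_of_pos hn']
      _ ≤ (n : ℝ) * (|x| ^ 3 / (1 - |x|)) := by gcongr
      _ = n * x ^ 2 * (|x| / (1 - |x|)) := by
          rw [← sq_abs x]
          ring
  refine ((Real.continuous_exp.tendsto _).comp hexp).congr' ?_
  filter_upwards [tendsto_sqrt_natCast_atTop.eventually_gt_atTop (-s),
    eventually_gt_atTop 0] with n hs hn
  exact (scaledGammaDensity_eq_exp hn (by linarith)).symm

lemma integrable_exp_half_sub_abs :
    Integrable (fun s : ℝ => Real.exp (1 / 2 - 1 / 2 * |s|)) := by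
  rw [← integrableOn_univ, ← Set.Iic_union_Ioi (a := (0 : ℝ))]
  refine IntegrableOn.union ?_ ?_
  · refine IntegrableOn.congr_fun
      ((integrableOn_exp_mul_Iic (by norm_num : (0 : ℝ) < 1 / 2) 0).const_mul (Real.exp (1 / 2)))
      (fun s hs => ?_) measurableSet_Iic
    rw [← Real.exp_add, abs_of_nonpos hs]
    ring_nf
  · refine IntegrableOn.congr_fun
      ((integrableOn_exp_mul_Ioi (by norm_num : (-(1 / 2) : ℝ) < 0) 0).const_mul (Real.exp (1 / 2)))
      (fun s hs => ?_) measurableSet_Ioi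
    rw [← Real.exp_add, abs_of_pos hs]
    ring_nf

/-- Dominated convergence for the tails of the rescaled Gamma densities. -/
lemma tendsto_setIntegral_scaledGammaDensity {L : ℕ → ℝ} {A : Set ℝ} (hA : MeasurableSet A)
    (hL : ∀ᶠ n : ℕ in atTop, -√n ≤ L n)
    (hmem : ∀ s ≠ 0, ∀ᶠ n in atTop, (L n < s ↔ s ∈ A)) :
    Tendsto (fun n => ∫ s in Set.Ioi (L n), scaledGammaDensity n s) atTop
      (nhds (∫ s in A, Real.exp (-(1 / 2) * s ^ 2))) := by
  simp only [← integral_indicator measurableSet_Ioi, ← integral_indicator hA]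
  refine tendsto_integral_filter_of_dominated_convergence
    (fun s : ℝ => Real.exp (1 / 2 - 1 / 2 * |s|)) (Eventually.of_forall fun n => ?_) ?_
    integrable_exp_half_sub_abs ?_
  · refine Measurable.aestronglyMeasurable (Measurable.indicator ?_ measurableSet_Ioi)
    unfold scaledGammaDensity
    fun_prop
  · filter_upwards [hL, eventually_gt_atTop 0] with n hn h0
    refine Eventually.of_forall fun s => ?_
    by_cases hs : s ∈ Set.Ioi (L n)
    · have hs' : -√n < s := hn.trans_lt hs
      rw [Set.indicator_of_mem hs, Real.norm_of_nonneg (scaledGammaDensity_nonneg h0 hs')]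
      exact scaledGammaDensity_le h0 hs'
    · rw [Set.indicator_of_notMem hs, norm_zero]
      positivity
  · filter_upwards [Measure.ae_ne volume (0 : ℝ)] with s hs
    by_cases hsA : s ∈ A
    · rw [Set.indicator_of_mem hsA]
      refine (tendsto_scaledGammaDensity s).congr' ?_
      filter_upwards [hmem s hs] with n hn
      exact (Set.indicator_of_mem (hn.2 hsA) _).symm
    · rw [Set.indicator_of_notMem hsA]
      refine tendsto_const_nhds.congr' ?_
      filter_upwards [hmem s hs] with n hn
      exact (Set.indicator_of_notMem (fun h => hsA (hn.1 h)) _).symm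

lemma incGamma_add_two {n : ℕ} (hn : 0 < n) (c : ℝ) :
    incGamma (n + 2) c = √n * (Real.exp (-n) * n ^ n) *
      ∫ s in Set.Ioi ((c - n) / √n), scaledGammaDensity n s := by
  have hr : 0 < √(n : ℝ) := by positivity
  have hrr : √(n : ℝ) * √n = n := Real.mul_self_sqrt (Nat.cast_nonneg n)
  set F : ℝ → ℝ := (Set.Ioi c).indicator fun t => Real.exp (-t) * t ^ n with hF
  have h1 : ∫ s, F (√n * s + n) = |(√(n : ℝ))⁻¹| • ∫ t, F t := by
    rw [Measure.integral_comp_mul_left (fun t => F (t + n)), integral_add_right_eq_self]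
  have h2 : ∀ s, F (√n * s + n) = (Real.exp (-n) * n ^ n) *
      (Set.Ioi ((c - n) / √n)).indicator (scaledGammaDensity n) s := by
    intro s
    have hiff : c < √n * s + n ↔ (c - n) / √n < s := by
      rw [div_lt_iff₀ hr]
      constructor <;> intro h <;> linarith
    by_cases hs : c < √n * s + n
    · rw [hF, Set.indicator_of_mem (Set.mem_Ioi.2 hs),
        Set.indicator_of_mem (Set.mem_Ioi.2 (hiff.1 hs)), scaledGammaDensity]
      have e : √n * s + n = n * (1 + s / √n) := by
        rw [mul_add, mul_one, add_comm, mul_div_assoc', mul_div_right_comm, Real.div_sqrt]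
      rw [neg_add, Real.exp_add, e, mul_pow]
      ring
    · rw [hF, Set.indicator_of_notMem (by simpa using hs),
        Set.indicator_of_notMem (by simpa using fun h => hs (hiff.2 h)), mul_zero]
  simp only [h2, integral_const_mul] at h1
  rw [integral_indicator measurableSet_Ioi, hF, integral_indicator measurableSet_Ioi,
    abs_of_pos (inv_pos.2 hr), smul_eq_mul] at h1
  rw [incGamma, Nat.add_sub_cancel, mul_assoc, h1, mul_inv_cancel_left₀ hr.ne']

lemma integral_exp_neg_half_sq : ∫ s : ℝ, Real.exp (-(1 / 2) * s ^ 2) = √(π / (1 / 2)) :=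
  integral_gaussian _

lemma tendsto_incGamma_ratio {a : ℝ} (ha : 0 ≤ a) {A : Set ℝ} (hA : MeasurableSet A)
    (hmem : ∀ s ≠ 0, ∀ᶠ n : ℕ in atTop, ((((n + 2 : ℕ) : ℝ) * a - n) / √n < s ↔ s ∈ A)) :
    Tendsto (fun N : ℕ => incGamma N ((N : ℝ) * a) / incGamma N 0) atTop
      (nhds ((∫ s in A, Real.exp (-(1 / 2) * s ^ 2)) / √(π / (1 / 2)))) := by
  rw [← tendsto_add_atTop_iff_nat 2]
  have hle : ∀ n : ℕ, ∀ c : ℝ, 0 ≤ c → -√n ≤ (c - n) / √n := by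
    intro n c hc
    rw [sub_div, Real.div_sqrt]
    have : 0 ≤ c / √n := by positivity
    linarith
  have htail := tendsto_setIntegral_scaledGammaDensity hA
    (Eventually.of_forall fun n => hle n (((n + 2 : ℕ) : ℝ) * a) (by positivity)) hmem
  have htotal := tendsto_setIntegral_scaledGammaDensity (L := fun n => (0 - n) / √n)
    MeasurableSet.univ (Eventually.of_forall fun n => hle n 0 le_rfl) (fun s _ => by
      filter_upwards [tendsto_sqrt_natCast_atTop.eventually_gt_atTop (-s)] with n hn
      rw [zero_sub, neg_div, Real.div_sqrt]
      simp only [Set.mem_univ, iff_true]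
      linarith)
  rw [setIntegral_univ, integral_exp_neg_half_sq] at htotal
  refine (htail.div htotal (by positivity)).congr' ?_
  filter_upwards [eventually_gt_atTop 0] with n hn
  rw [incGamma_add_two hn, incGamma_add_two hn, Pi.div_apply, mul_div_mul_left]
  positivity

/-- Limiting behavior of the incomplete gamma ratio `G(N−1, Na)/Γ(N−1)`:
it tends to `1` for `0 ≤ a < 1`, to `1/2` for `a = 1`, and to `0` for `a > 1`. -/
theorem incGamma_ratio_limit (a : ℝ) (ha : 0 ≤ a) :
    (a < 1 →
      Tendsto (fun N : ℕ => incGamma N ((N : ℝ) * a) / incGamma N 0) atTop (nhds 1)) ∧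
    (a = 1 →
      Tendsto (fun N : ℕ => incGamma N ((N : ℝ) * a) / incGamma N 0) atTop (nhds (1/2))) ∧
    (1 < a →
      Tendsto (fun N : ℕ => incGamma N ((N : ℝ) * a) / incGamma N 0) atTop (nhds 0)) := by
  have hpi : √(π / (1 / 2)) ≠ 0 := by positivity
  have hL : ∀ n : ℕ, (((n + 2 : ℕ) : ℝ) * a - n) / √n = √n * (a - 1) + 2 * a / √n := by
    intro n
    have : (((n + 2 : ℕ) : ℝ) * a - n) = n * (a - 1) + 2 * a := by push_cast; ring
    rw [this, add_div, mul_div_right_comm, Real.div_sqrt]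
  have hzero : Tendsto (fun n : ℕ => 2 * a / √(n : ℝ)) atTop (nhds 0) :=
    tendsto_sqrt_natCast_atTop.const_div_atTop _
  refine ⟨fun h => ?_, fun h => ?_, fun h => ?_⟩
  · have hbot := (tendsto_sqrt_natCast_atTop.atTop_mul_const_of_neg (sub_neg.2 h)).atBot_add hzero
    have := tendsto_incGamma_ratio ha MeasurableSet.univ fun s _ => by
      filter_upwards [hbot.eventually_lt_atBot s] with n hn
      rw [hL]
      exact iff_of_true hn (Set.mem_univ s)
    rwa [setIntegral_univ, integral_exp_neg_half_sq, div_self hpi] at this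
  · have := tendsto_incGamma_ratio ha (measurableSet_Ioi (a := (0 : ℝ))) fun s hs => by
      simp only [hL, sub_eq_zero.2 h, mul_zero, zero_add, Set.mem_Ioi]
      rcases lt_or_gt_of_ne hs with hs | hs
      · refine Eventually.of_forall fun n => iff_of_false (not_lt.2 (hs.le.trans ?_)) hs.not_gt
        positivity
      · filter_upwards [hzero.eventually_lt_const hs] with n hn
        exact iff_of_true hn hs
    rwa [integral_gaussian_Ioi, div_right_comm, div_self hpi] at this
  · have htop := (tendsto_sqrt_natCast_atTop.atTop_mul_const (sub_pos.2 h)).atTop_add hzero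
    have := tendsto_incGamma_ratio ha MeasurableSet.empty fun s _ => by
      filter_upwards [htop.eventually_gt_atTop s] with n hn
      rw [hL]
      exact iff_of_false hn.not_gt (Set.notMem_empty s)
    simpa using this
end

section
/- Let β > 0 and define F : ℝ → ℝ by F(δ) = ∫₀^∞ e^{−β(q + 2δ)²/2} · √q dq. Then lim_{δ → −∞} F(δ)/√(−δ) = 2·√(π/β). -/
open Real MeasureTheory Filter

/-- The edge profile `F(δ) = ∫₀^∞ e^{−β(q+2δ)²/2} √q dq` for the density of real
parts of complex eigenvalues. -/
noncomputable def edgeProfileC (β δ : ℝ) : ℝ :=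
  ∫ q in Set.Ioi (0:ℝ), Real.exp (-β * (q + 2*δ)^2 / 2) * Real.sqrt q

/-- The edge profile as a Gaussian average over the whole line: `Real.sqrt` vanishes on negative
arguments, so the half-line constraint is automatic after translating by `2δ`. -/
theorem edgeProfileC_div_sqrt_eq_integral (β : ℝ) {δ : ℝ} (hδ : δ < 0) :
    edgeProfileC β δ / Real.sqrt (-δ) =
      ∫ t : ℝ, Real.exp (-(β / 2) * t ^ 2) * Real.sqrt (2 + t / (-δ)) := by
  have h1 : edgeProfileC β δ =
      ∫ q : ℝ, Real.exp (-β * (q + 2 * δ) ^ 2 / 2) * Real.sqrt q := by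
    refine setIntegral_eq_integral_of_forall_compl_eq_zero fun q hq => ?_
    rw [Real.sqrt_eq_zero_of_nonpos (by simpa using hq), mul_zero]
  rw [h1, ← integral_sub_right_eq_self _ (2 * δ), ← integral_div]
  refine integral_congr_ae (Eventually.of_forall fun t => ?_)
  have h2 : 2 + t / (-δ) = (t - 2 * δ) / (-δ) := by
    have := hδ.ne
    field_simp
    ring
  simp only [h2, Real.sqrt_div' _ (neg_pos.2 hδ).le, mul_div_assoc, sub_add_cancel]
  congr 2
  ring

theorem integrable_gaussian_mul_two_add_abs {b : ℝ} (hb : 0 < b) :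
    Integrable fun t : ℝ => Real.exp (-b * t ^ 2) * (2 + |t|) := by
  refine (((integrable_exp_neg_mul_sq hb).const_mul 2).add
    (integrable_mul_exp_neg_mul_sq hb).norm).congr (Eventually.of_forall fun t => ?_)
  simp only [Pi.add_apply, norm_mul, Real.norm_eq_abs, Real.abs_exp]
  ring

/-- As `δ → −∞`, `F(δ)/√(−δ) → 2√(π/β)`, matching the semicircular bulk density. -/
theorem edgeProfileC_tendsto_atBot (β : ℝ) (hβ : 0 < β) :
    Tendsto (fun δ : ℝ => edgeProfileC β δ / Real.sqrt (-δ)) atBot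
      (nhds (2 * Real.sqrt (Real.pi / β))) := by
  have hlim : ∫ t : ℝ, Real.exp (-(β / 2) * t ^ 2) * Real.sqrt 2 =
      2 * Real.sqrt (Real.pi / β) := by
    rw [integral_mul_const, integral_gaussian, ← Real.sqrt_mul' _ (by norm_num),
      show Real.pi / (β / 2) * 2 = 2 ^ 2 * (Real.pi / β) by field_simp,
      Real.sqrt_mul (by positivity), Real.sqrt_sq (by norm_num)]
  rw [← hlim]
  have hlt : ∀ᶠ δ : ℝ in atBot, δ < 0 := eventually_lt_atBot 0
  refine Tendsto.congr' (hlt.mono fun δ hδ => (edgeProfileC_div_sqrt_eq_integral β hδ).symm) ?_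
  refine tendsto_integral_filter_of_dominated_convergence
    (fun t => Real.exp (-(β / 2) * t ^ 2) * (2 + |t|)) ?_ ?_
    (integrable_gaussian_mul_two_add_abs (half_pos hβ)) ?_
  · exact Eventually.of_forall fun δ => Continuous.aestronglyMeasurable (by fun_prop)
  · filter_upwards [eventually_le_atBot (-1 : ℝ)] with δ hδ
    refine Eventually.of_forall fun t => ?_
    rw [norm_mul, Real.norm_of_nonneg (Real.exp_pos _).le,
      Real.norm_of_nonneg (Real.sqrt_nonneg _)]
    gcongr
    have h1 : t / (-δ) ≤ |t| :=
      (div_le_div_of_nonneg_right (le_abs_self t) (by linarith)).trans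
        (div_le_self (abs_nonneg t) (by linarith))
    rw [Real.sqrt_le_left (by positivity)]
    nlinarith [abs_nonneg t]
  · refine Eventually.of_forall fun t => Tendsto.const_mul _ ?_
    have h0 : Tendsto (fun δ : ℝ => t / (-δ)) atBot (nhds 0) :=
      tendsto_neg_atBot_atTop.const_div_atTop t
    simpa using (h0.const_add 2).sqrt
end

section
/- Let β > 0 and define F : ℝ → ℝ by F(δ) = ∫₀^∞ e^{−β(q + 2δ)²/2} · √q dq. Then lim_{δ → +∞} F(δ) · e^{2βδ²} · (2βδ)^{3/2} = √π/2. -/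
open Real MeasureTheory Filter

theorem integral_exp_neg_mul_sqrt_Ioi :
    ∫ x in Set.Ioi (0:ℝ), exp (-x) * √x = √π / 2 := by
  have h := Real.Gamma_eq_integral (s := 3 / 2) (by norm_num)
  rw [show (3 / 2 : ℝ) = 1 / 2 + 1 by norm_num, Real.Gamma_add_one (by norm_num),
    Real.Gamma_one_half_eq] at h
  simp only [add_sub_cancel_right, ← Real.sqrt_eq_rpow] at h
  rw [← h]
  ring

theorem integrableOn_exp_neg_mul_sqrt_Ioi :
    IntegrableOn (fun x : ℝ => exp (-x) * √x) (Set.Ioi 0) := by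
  have h := Real.GammaIntegral_convergent (s := 1 / 2 + 1) (by norm_num)
  simpa only [add_sub_cancel_right, ← Real.sqrt_eq_rpow] using h

/-- Rescaling `q = x / (2βδ)` extracts the exponential and power prefactors. -/
theorem edgeProfileC_mul_eq_integral {β δ : ℝ} (hβ : 0 < β) (hδ : 0 < δ) :
    edgeProfileC β δ * exp (2 * β * δ ^ 2) * (2 * β * δ) ^ ((3:ℝ) / 2) =
      ∫ x in Set.Ioi (0:ℝ), exp (-(β * (x * (2 * β * δ)⁻¹) ^ 2 / 2)) * (exp (-x) * √x) := by
  have hc : 0 < 2 * β * δ := by positivity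
  have hsub := integral_comp_mul_left_Ioi'
    (fun q : ℝ => exp (-β * (q + 2 * δ) ^ 2 / 2) * √q) 0 (inv_pos.mpr hc)
  rw [mul_zero] at hsub
  have hpow : (2 * β * δ) ^ ((3:ℝ) / 2) = 2 * β * δ * √(2 * β * δ) := by
    rw [show (3:ℝ) / 2 = 1 + 1 / 2 by norm_num, rpow_add hc, rpow_one, sqrt_eq_rpow]
  rw [edgeProfileC, ← hsub, hpow, smul_eq_mul]
  have hcancel (I : ℝ) : (2 * β * δ)⁻¹ * I * exp (2 * β * δ ^ 2) *
      (2 * β * δ * √(2 * β * δ)) = exp (2 * β * δ ^ 2) * √(2 * β * δ) * I := by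
    field_simp
  rw [hcancel, ← integral_const_mul]
  refine integral_congr_ae (Eventually.of_forall fun x => ?_)
  have hexp : exp (2 * β * δ ^ 2) * exp (-β * ((2 * β * δ)⁻¹ * x + 2 * δ) ^ 2 / 2) =
      exp (-(β * (x * (2 * β * δ)⁻¹) ^ 2 / 2)) * exp (-x) := by
    rw [← exp_add, ← exp_add]
    congr 1
    field_simp
    ring
  have hsqrt : √(2 * β * δ) * √((2 * β * δ)⁻¹ * x) = √x := by
    rw [← sqrt_mul hc.le, mul_inv_cancel_left₀ hc.ne']
  calc _ = (exp (2 * β * δ ^ 2) * exp (-β * ((2 * β * δ)⁻¹ * x + 2 * δ) ^ 2 / 2)) *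
        (√(2 * β * δ) * √((2 * β * δ)⁻¹ * x)) := by ring
    _ = _ := by rw [hexp, hsqrt, mul_assoc]

/-- As `δ → +∞`, `F(δ)·e^{2βδ²}·(2βδ)^{3/2} → √π/2`, matching the large-deviation
tail of the integrated density of complex eigenvalues. -/
theorem edgeProfileC_asymptotics_atTop (β : ℝ) (hβ : 0 < β) :
    Tendsto
      (fun δ : ℝ => edgeProfileC β δ * Real.exp (2*β*δ^2) * (2*β*δ) ^ ((3:ℝ)/2))
      atTop (nhds (Real.sqrt Real.pi / 2)) := by
  rw [← integral_exp_neg_mul_sqrt_Ioi]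
  refine Tendsto.congr' (f₁ := fun δ : ℝ =>
    ∫ x in Set.Ioi (0:ℝ), exp (-(β * (x * (2 * β * δ)⁻¹) ^ 2 / 2)) * (exp (-x) * √x)) ?_ ?_
  · filter_upwards [eventually_gt_atTop 0] with δ hδ
    exact (edgeProfileC_mul_eq_integral hβ hδ).symm
  · refine tendsto_integral_filter_of_dominated_convergence (fun x => exp (-x) * √x)
      (Eventually.of_forall fun δ => ?_) (Eventually.of_forall fun δ => ?_)
      integrableOn_exp_neg_mul_sqrt_Ioi (Eventually.of_forall fun x => ?_)
    · exact Continuous.aestronglyMeasurable (by fun_prop)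
    · refine Eventually.of_forall fun x => ?_
      rw [norm_of_nonneg (by positivity)]
      refine mul_le_of_le_one_left (by positivity) (exp_le_one_iff.mpr ?_)
      exact neg_nonpos.mpr (by positivity)
    · have hinv : Tendsto (fun δ : ℝ => (2 * β * δ)⁻¹) atTop (nhds 0) :=
        tendsto_inv_atTop_zero.comp (tendsto_id.const_mul_atTop (by positivity))
      have hlim : Tendsto (fun t : ℝ => exp (-(β * (x * t) ^ 2 / 2)) * (exp (-x) * √x))
          (nhds 0) (nhds (exp (-x) * √x)) :=
        Continuous.tendsto' (by fun_prop) _ _ (by simp)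
      exact hlim.comp hinv
end

section
/- Let 0 < τ < 1 and 0 < m < 1. Then lim_{N→∞} √N · √(π(1+τ)/(8τ(1−m²))) · (2/π) · ∫_{−1}^{1} √(1 − u²) · e^{−N(1+τ)(u−m)²/(2τ)} du = 1, where the limit is over natural numbers N → ∞. -/
open Real MeasureTheory Filter

/-- Laplace's method for a Gaussian peak: the rescaled Gaussian `√c * exp (-c b (u - x₀)²)`
converges to `√(π / b)` times the Dirac mass at `x₀`. -/
theorem tendsto_sqrt_mul_integral_gaussian_mul {b x₀ : ℝ} (hb : 0 < b) {g : ℝ → ℝ}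
    (hg : Integrable g) (hgc : ContinuousAt g x₀) :
    Tendsto (fun c : ℝ => √c * ∫ u, g u * exp (-c * b * (u - x₀) ^ 2)) atTop
      (nhds (√(π / b) * g x₀)) := by
  have hK : 0 < √(π / b) := sqrt_pos.2 (div_pos pi_pos hb)
  have key := tendsto_integral_comp_smul_smul_of_integrable' (μ := volume) (F := ℝ)
    (φ := fun x => (√(π / b))⁻¹ * exp (-b * x ^ 2)) (fun x => by positivity)
    (by rw [integral_const_mul, integral_gaussian, inv_mul_cancel₀ hK.ne'])
    (by
      have h := (tendsto_rpow_abs_mul_exp_neg_mul_sq_cocompact hb 1).const_mul (√(π / b))⁻¹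
      rw [mul_zero] at h
      rw [Metric.cobounded_eq_cocompact]
      refine h.congr fun x => ?_
      simp only [rpow_one, Module.finrank_self, pow_one, norm_eq_abs]
      ring)
    hg hgc
  refine ((key.comp tendsto_sqrt_atTop).const_mul √(π / b)).congr' ?_
  filter_upwards [eventually_ge_atTop 0] with c hc
  simp only [Function.comp_apply, Module.finrank_self, pow_one, smul_eq_mul]
  rw [← integral_const_mul, ← integral_const_mul]
  congr 1 with u
  rw [mul_pow, sq_sqrt hc, show -b * (c * (x₀ - u) ^ 2) = -c * b * (u - x₀) ^ 2 by ring]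
  field_simp

/-- Laplace-method limit determining the normalization constant of the relative
density of α-stable equilibria:
`√N · √(π(1+τ)/(8τ(1−m²))) · (2/π) ∫_{−1}^1 √(1−u²) e^{−N(1+τ)(u−m)²/(2τ)} du → 1`. -/
theorem normalization_constant_limit
    (τ m : ℝ) (hτ0 : 0 < τ) (hτ1 : τ < 1) (hm0 : 0 < m) (hm1 : m < 1) :
    Tendsto
      (fun N : ℕ =>
        Real.sqrt (N : ℝ) * Real.sqrt (Real.pi * (1+τ) / (8*τ*(1 - m^2))) * (2/Real.pi) *
          ∫ u in (-1:ℝ)..1,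
            Real.sqrt (1 - u^2) * Real.exp (-(N : ℝ) * (1+τ) * (u - m)^2 / (2*τ)))
      atTop (nhds 1) := by
  have hm : 0 < 1 - m ^ 2 := by nlinarith
  have hb : 0 < (1 + τ) / (2 * τ) := by positivity
  have hcont : Continuous fun u : ℝ => √(1 - u ^ 2) := by fun_prop
  have hmem : Set.Ioc (-1 : ℝ) 1 ∈ nhds m := Ioc_mem_nhds (by linarith) hm1
  have hg : Integrable ((Set.Ioc (-1 : ℝ) 1).indicator fun u => √(1 - u ^ 2)) :=
    (hcont.integrableOn_Ioc).integrable_indicator measurableSet_Ioc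
  have hgc : ContinuousAt ((Set.Ioc (-1 : ℝ) 1).indicator fun u => √(1 - u ^ 2)) m :=
    hcont.continuousAt.congr <| by
      filter_upwards [hmem] with u hu
      rw [Set.indicator_of_mem hu]
  have key := ((tendsto_sqrt_mul_integral_gaussian_mul hb hg hgc).comp
    tendsto_natCast_atTop_atTop).const_mul (√(π * (1 + τ) / (8 * τ * (1 - m ^ 2))) * (2 / π))
  have hval : √(π * (1 + τ) / (8 * τ * (1 - m ^ 2))) * (2 / π) *
      (√(π / ((1 + τ) / (2 * τ))) * √(1 - m ^ 2)) = 1 := by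
    have h : √(π * (1 + τ) / (8 * τ * (1 - m ^ 2))) *
        (√(π / ((1 + τ) / (2 * τ))) * √(1 - m ^ 2)) = π / 2 := by
      rw [← sqrt_mul (by positivity), ← sqrt_mul (by positivity),
        ← sqrt_sq (show 0 ≤ π / 2 by positivity)]
      congr 1
      field_simp
      norm_num
    rw [mul_right_comm, h]
    field_simp
  rw [Set.indicator_of_mem (mem_of_mem_nhds hmem), hval] at key
  refine key.congr fun N => ?_
  rw [Function.comp_apply, intervalIntegral.integral_of_le (by norm_num),
    ← integral_indicator measurableSet_Ioc]
  have h : ∀ u : ℝ, (Set.Ioc (-1 : ℝ) 1).indicator (fun u => √(1 - u ^ 2)) u *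
      exp (-(N : ℝ) * ((1 + τ) / (2 * τ)) * (u - m) ^ 2) =
      (Set.Ioc (-1 : ℝ) 1).indicator
        (fun u => √(1 - u ^ 2) * exp (-(N : ℝ) * (1 + τ) * (u - m) ^ 2 / (2 * τ))) u := by
    intro u
    rw [Set.indicator_mul_left]
    congr 2
    ring
  simp only [h]
  ring
end
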